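/- arXiv:2510.26264 — 5 statements merged into one kernel-verified Lean document; each statement's English description precedes it below -/
import Mathlib

section
/- Let U and V be strings of equal length over some alphabet, let k be a nonnegative integer with δ_H(U,V) ≤ k, and let 0 ≤ i < j ≤ |U| be indices with U[i..j) = V[i..j). Let I = Misper_{k+1}(U,i,j) and I' = Misper_{k+1}(V,i,j). If I ∩ I' = ∅, then δ_H(U,V) = |I| + |I'|, I = Misper(U,i,j), and I' = Misper(V,i,j). -/
/-- The unique position `b ∈ [i .. i+p)` with `p ∣ (b - a)` (congruent to `a` mod `p`). -/
def projPos (i p a : ℕ) : ℕ := i + ((a % p + p - i % p) % p)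

/-- Hamming distance of two length-`n` strings (given as functions `ℕ → α`). -/
def hammingN {α : Type*} [DecidableEq α] (n : ℕ) (U V : ℕ → α) : ℕ :=
  ((Finset.range n).filter fun a => U a ≠ V a).card

/-- Misperiods of `S` (of length `n`) with respect to the fragment `S[i..j)`. -/
def misperiods {α : Type*} [DecidableEq α] (n : ℕ) (S : ℕ → α) (i j : ℕ) : Finset ℕ :=
  (Finset.range n).filter fun a => S a ≠ S (projPos i (j - i) a)

/-- The (at most) `k` largest elements of a finite set of naturals. -/
def topK (k : ℕ) (M : Finset ℕ) : Finset ℕ :=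
  M.filter fun a => (M.filter fun b => a ≤ b).card ≤ k

/-- The (at most) `k` smallest elements of a finite set of naturals. -/
def botK (k : ℕ) (M : Finset ℕ) : Finset ℕ :=
  M.filter fun a => (M.filter fun b => b ≤ a).card ≤ k

/-- `Misper_k(S,i,j)`: the `k` largest misperiods smaller than `i` together with the
`k` smallest misperiods that are at least `j`. -/
def misperK {α : Type*} [DecidableEq α] (k n : ℕ) (S : ℕ → α) (i j : ℕ) : Finset ℕ :=
  topK k ((misperiods n S i j).filter fun a => a < i) ∪
  botK k ((misperiods n S i j).filter fun a => j ≤ a)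

/-- `Misper(S,i,j) = Misper_{|S|}(S,i,j)`. -/
def misperAll {α : Type*} [DecidableEq α] (n : ℕ) (S : ℕ → α) (i j : ℕ) : Finset ℕ :=
  misperK n n S i j

/-- `p` is a period of the length-`len` fragment of `S` starting at position `x`. -/
def IsPeriod {α : Type*} (S : ℕ → α) (x len p : ℕ) : Prop :=
  1 ≤ p ∧ p ≤ len ∧ ∀ a, a + p < len → S (x + a) = S (x + a + p)

/-- `per`: the smallest period of the length-`len` fragment of `S` starting at `x`. -/
noncomputable def perOf {α : Type*} (S : ℕ → α) (x len : ℕ) : ℕ :=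
  sInf {p | IsPeriod S x len p}

/-- `T[x..y]` is a run of the length-`n` string `T`. -/
def IsRun {α : Type*} (n : ℕ) (T : ℕ → α) (x y : ℕ) : Prop :=
  x ≤ y ∧ y < n ∧
  2 * perOf T x (y - x + 1) ≤ y - x + 1 ∧
  (x = 0 ∨ T (x - 1) ≠ T (x - 1 + perOf T x (y - x + 1))) ∧
  (y = n - 1 ∨ T (y + 1) ≠ T (y + 1 - perOf T x (y - x + 1)))

/-- `T[x..y]` is a `τ`-run: a run of length at least `3τ - 1` and period at most `τ/3`. -/
def IsTauRun {α : Type*} (n : ℕ) (T : ℕ → α) (τ x y : ℕ) : Prop :=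
  IsRun n T x y ∧ 3 * τ ≤ y - x + 2 ∧ 3 * perOf T x (y - x + 1) ≤ τ

/-- `A` is a `τ`-synchronizing set of the length-`n` string `T`. -/
def IsSyncSet {α : Type*} (n τ : ℕ) (T : ℕ → α) (A : Finset ℕ) : Prop :=
  (∀ a ∈ A, a + 2 * τ ≤ n) ∧
  (∀ i j : ℕ, i + 2 * τ ≤ n → j + 2 * τ ≤ n →
      (∀ d < 2 * τ, T (i + d) = T (j + d)) → (i ∈ A ↔ j ∈ A)) ∧
  (∀ i : ℕ, i + 3 * τ ≤ n + 1 →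
      ((∀ d < τ, i + d ∉ A) ↔ 3 * perOf T i (3 * τ - 1) ≤ τ))

/-- The fragment `P[x..x+len)` occurs in the length-`n` string `T`. -/
def OccursIn {α : Type*} (n : ℕ) (T : ℕ → α) (P : ℕ → α) (x len : ℕ) : Prop :=
  ∃ s, s + len ≤ n ∧ ∀ d < len, T (s + d) = P (x + d)

theorem le_projPos (i p a : ℕ) : i ≤ projPos i p a := Nat.le_add_right _ _

theorem projPos_lt {i j : ℕ} (hij : i < j) (a : ℕ) : projPos i (j - i) a < j := by
  have := Nat.mod_lt (a % (j - i) + (j - i) - i % (j - i)) (Nat.sub_pos_of_lt hij)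
  unfold projPos
  omega

theorem projPos_eq_self {i j a : ℕ} (hia : i ≤ a) (haj : a < j) :
    projPos i (j - i) a = a := by
  obtain ⟨d, rfl⟩ := Nat.exists_eq_add_of_le hia
  obtain ⟨p, rfl⟩ := Nat.exists_eq_add_of_le (hia.trans haj.le)
  have hd : d < p := by omega
  have hr : i % p < p := Nat.mod_lt _ (by omega)
  rw [projPos, Nat.add_sub_cancel_left, Nat.add_mod i d, Nat.mod_eq_of_lt hd]
  congr 1
  by_cases h : i % p + d < p
  · rw [Nat.mod_eq_of_lt h, show i % p + d + p - i % p = d + p by omega,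
      Nat.add_mod_right, Nat.mod_eq_of_lt hd]
  · rw [Nat.mod_eq_sub_mod (by omega : p ≤ i % p + d),
      Nat.mod_eq_of_lt (by omega : i % p + d - p < p),
      show i % p + d - p + p - i % p = d by omega, Nat.mod_eq_of_lt hd]

theorem topK_eq_self {k : ℕ} {M : Finset ℕ} (h : M.card ≤ k) : topK k M = M :=
  Finset.filter_true_of_mem fun _ _ => (Finset.card_filter_le _ _).trans h

theorem botK_eq_self {k : ℕ} {M : Finset ℕ} (h : M.card ≤ k) : botK k M = M :=
  Finset.filter_true_of_mem fun _ _ => (Finset.card_filter_le _ _).trans h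

/-- An element with at most `k` larger elements is among the `k + 1` largest ones. -/
theorem mem_topK_succ {k c : ℕ} {M D : Finset ℕ} (hc : c ∈ M)
    (hM : ∀ b ∈ M, c < b → b ∈ D) (hD : D.card ≤ k) : c ∈ topK (k + 1) M := by
  refine Finset.mem_filter.2 ⟨hc, ?_⟩
  refine (Finset.card_le_card (t := insert c D) fun b hb => ?_).trans
    ((Finset.card_insert_le c D).trans (by omega))
  obtain ⟨hb, hcb⟩ := Finset.mem_filter.1 hb
  rcases hcb.eq_or_lt with rfl | h
  · exact Finset.mem_insert_self _ _
  · exact Finset.mem_insert_of_mem (hM b hb h)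

/-- An element with at most `k` smaller elements is among the `k + 1` smallest ones. -/
theorem mem_botK_succ {k c : ℕ} {M D : Finset ℕ} (hc : c ∈ M)
    (hM : ∀ b ∈ M, b < c → b ∈ D) (hD : D.card ≤ k) : c ∈ botK (k + 1) M := by
  refine Finset.mem_filter.2 ⟨hc, ?_⟩
  refine (Finset.card_le_card (t := insert c D) fun b hb => ?_).trans
    ((Finset.card_insert_le c D).trans (by omega))
  obtain ⟨hb, hcb⟩ := Finset.mem_filter.1 hb
  rcases hcb.eq_or_lt with rfl | h
  · exact Finset.mem_insert_self _ _
  · exact Finset.mem_insert_of_mem (hM b hb h)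

/-- If `A` and `B` differ in at most `k` elements and their `k + 1` largest elements are
disjoint, then `A` and `B` are disjoint. -/
theorem disjoint_of_disjoint_topK {k : ℕ} {A B D : Finset ℕ} (hAB : A \ B ⊆ D)
    (hBA : B \ A ⊆ D) (hD : D.card ≤ k) (h : Disjoint (topK (k + 1) A) (topK (k + 1) B)) :
    Disjoint A B := by
  by_contra hne
  rw [Finset.not_disjoint_iff_nonempty_inter] at hne
  have hc := Finset.mem_inter.1 ((A ∩ B).max'_mem hne)
  have hmax := fun b (hb : b ∈ A ∩ B) => (A ∩ B).le_max' b hb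
  refine Finset.disjoint_left.1 h (mem_topK_succ hc.1 (fun b hb hlt => hAB ?_) hD)
    (mem_topK_succ hc.2 (fun b hb hlt => hBA ?_) hD)
  · exact Finset.mem_sdiff.2 ⟨hb, fun h' => (hmax b (Finset.mem_inter.2 ⟨hb, h'⟩)).not_gt hlt⟩
  · exact Finset.mem_sdiff.2 ⟨hb, fun h' => (hmax b (Finset.mem_inter.2 ⟨h', hb⟩)).not_gt hlt⟩

/-- If `A` and `B` differ in at most `k` elements and their `k + 1` smallest elements are
disjoint, then `A` and `B` are disjoint. -/
theorem disjoint_of_disjoint_botK {k : ℕ} {A B D : Finset ℕ} (hAB : A \ B ⊆ D)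
    (hBA : B \ A ⊆ D) (hD : D.card ≤ k) (h : Disjoint (botK (k + 1) A) (botK (k + 1) B)) :
    Disjoint A B := by
  by_contra hne
  rw [Finset.not_disjoint_iff_nonempty_inter] at hne
  have hc := Finset.mem_inter.1 ((A ∩ B).min'_mem hne)
  have hmin := fun b (hb : b ∈ A ∩ B) => (A ∩ B).min'_le b hb
  refine Finset.disjoint_left.1 h (mem_botK_succ hc.1 (fun b hb hlt => hAB ?_) hD)
    (mem_botK_succ hc.2 (fun b hb hlt => hBA ?_) hD)
  · exact Finset.mem_sdiff.2 ⟨hb, fun h' => (hmin b (Finset.mem_inter.2 ⟨hb, h'⟩)).not_gt hlt⟩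
  · exact Finset.mem_sdiff.2 ⟨hb, fun h' => (hmin b (Finset.mem_inter.2 ⟨h', hb⟩)).not_gt hlt⟩

section Misperiods

variable {α : Type*} [DecidableEq α]

theorem mem_misperiods {n : ℕ} {S : ℕ → α} {i j a : ℕ} :
    a ∈ misperiods n S i j ↔ a < n ∧ S a ≠ S (projPos i (j - i) a) := by
  simp [misperiods]

theorem misperK_eq_misperiods {K n : ℕ} {S : ℕ → α} {i j : ℕ}
    (h : (misperiods n S i j).card ≤ K) : misperK K n S i j = misperiods n S i j := by
  rw [misperK, topK_eq_self ((Finset.card_filter_le _ _).trans h),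
    botK_eq_self ((Finset.card_filter_le _ _).trans h), ← Finset.filter_or]
  refine Finset.filter_true_of_mem fun a ha => ?_
  by_contra hcon
  exact (mem_misperiods.1 ha).2 (by rw [projPos_eq_self (by omega) (by omega)])

theorem misperAll_eq_misperiods {n : ℕ} {S : ℕ → α} {i j : ℕ} :
    misperAll n S i j = misperiods n S i j :=
  misperK_eq_misperiods ((Finset.card_filter_le _ _).trans (Finset.card_range n).le)

theorem misperiods_sdiff_subset {n : ℕ} {U V : ℕ → α} {i j : ℕ} (hij : i < j)
    (hagree : ∀ a, i ≤ a → a < j → U a = V a) :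
    misperiods n U i j \ misperiods n V i j ⊆ (Finset.range n).filter fun a => U a ≠ V a := by
  intro a ha
  have hp := hagree _ (le_projPos i (j - i) a) (projPos_lt hij a)
  simp only [Finset.mem_sdiff, mem_misperiods, Finset.mem_filter, Finset.mem_range] at ha ⊢
  grind

/-- If `U` and `V` agree on `[i, j)` and have no common misperiod, then the mismatches of `U`
and `V` are exactly the misperiods of either. -/
theorem filter_ne_eq_misperiods_union {n : ℕ} {U V : ℕ → α} {i j : ℕ} (hij : i < j)
    (hagree : ∀ a, i ≤ a → a < j → U a = V a)
    (hdisj : Disjoint (misperiods n U i j) (misperiods n V i j)) :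
    ((Finset.range n).filter fun a => U a ≠ V a) =
      misperiods n U i j ∪ misperiods n V i j := by
  ext a
  have hp := hagree _ (le_projPos i (j - i) a) (projPos_lt hij a)
  have hd : a ∈ misperiods n U i j → a ∉ misperiods n V i j :=
    fun h => Finset.disjoint_left.1 hdisj h
  simp only [Finset.mem_union, mem_misperiods, Finset.mem_filter, Finset.mem_range] at hd ⊢
  grind

theorem disjoint_misperiods {n k : ℕ} {U V : ℕ → α} {i j : ℕ} (hij : i < j)
    (hdist : hammingN n U V ≤ k)
    (hagree : ∀ a, i ≤ a → a < j → U a = V a)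
    (hdisj : Disjoint (misperK (k + 1) n U i j) (misperK (k + 1) n V i j)) :
    Disjoint (misperiods n U i j) (misperiods n V i j) := by
  have hUV := misperiods_sdiff_subset (n := n) hij hagree
  have hVU : misperiods n V i j \ misperiods n U i j ⊆
      (Finset.range n).filter fun a => U a ≠ V a := by
    simpa only [ne_comm] using
      misperiods_sdiff_subset (n := n) hij fun a h₁ h₂ => (hagree a h₁ h₂).symm
  have hfilter : ∀ {A B D : Finset ℕ} (p : ℕ → Prop) [DecidablePred p], A \ B ⊆ D →
      A.filter p \ B.filter p ⊆ D := by
    intro A B D p _ h a ha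
    apply h
    simp only [Finset.mem_sdiff, Finset.mem_filter] at ha ⊢
    tauto
  have hleft := disjoint_of_disjoint_topK (hfilter (· < i) hUV) (hfilter (· < i) hVU) hdist
    (hdisj.mono Finset.subset_union_left Finset.subset_union_left)
  have hright := disjoint_of_disjoint_botK (hfilter (j ≤ ·) hUV) (hfilter (j ≤ ·) hVU) hdist
    (hdisj.mono Finset.subset_union_right Finset.subset_union_right)
  refine Finset.disjoint_left.2 fun a hU hV => ?_
  by_cases hai : a < i
  · exact Finset.disjoint_left.1 hleft (Finset.mem_filter.2 ⟨hU, hai⟩)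
      (Finset.mem_filter.2 ⟨hV, hai⟩)
  by_cases hja : j ≤ a
  · exact Finset.disjoint_left.1 hright (Finset.mem_filter.2 ⟨hU, hja⟩)
      (Finset.mem_filter.2 ⟨hV, hja⟩)
  exact (mem_misperiods.1 hU).2 (by rw [projPos_eq_self (by omega) (by omega)])

end Misperiods

/-- Lemma 13 of Charalampopoulos et al. (Statement 0): if `δ_H(U,V) ≤ k`, the strings agree
on `[i..j)`, and the sets `Misper_{k+1}(U,i,j)` and `Misper_{k+1}(V,i,j)` are disjoint, then
`δ_H(U,V) = |Misper_{k+1}(U,i,j)| + |Misper_{k+1}(V,i,j)|`, and these sets are the full sets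
of misperiods. -/
theorem stmt0 {α : Type*} [DecidableEq α] (n k : ℕ) (U V : ℕ → α)
    (i j : ℕ) (hij : i < j) (hjn : j ≤ n)
    (hdist : hammingN n U V ≤ k)
    (hagree : ∀ a, i ≤ a → a < j → U a = V a)
    (hdisj : misperK (k + 1) n U i j ∩ misperK (k + 1) n V i j = ∅) :
    hammingN n U V = (misperK (k + 1) n U i j).card + (misperK (k + 1) n V i j).card ∧
    misperK (k + 1) n U i j = misperAll n U i j ∧
    misperK (k + 1) n V i j = misperAll n V i j := by
  have hd := disjoint_misperiods hij hdist hagree (Finset.disjoint_iff_inter_eq_empty.2 hdisj)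
  have hcard : hammingN n U V = (misperiods n U i j).card + (misperiods n V i j).card := by
    rw [hammingN, filter_ne_eq_misperiods_union hij hagree hd, Finset.card_union_of_disjoint hd]
  rw [misperAll_eq_misperiods, misperAll_eq_misperiods,
    misperK_eq_misperiods (S := U) (by omega), misperK_eq_misperiods (S := V) (by omega)]
  exact ⟨hcard, rfl, rfl⟩
end

section
/- There exists a constant C > 0 such that for every string T of length n (over any alphabet) and every positive integer τ ≤ n/2, there exists a τ-synchronizing set of T of size at most C·n/τ. -/
/-- The length-`l` fragment of `T` starting at `j` has a period `p` with `3 * p ≤ τ`. -/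
def HasShortPeriod {α : Type*} (T : ℕ → α) (τ j l : ℕ) : Prop :=
  ∃ p, 1 ≤ p ∧ 3 * p ≤ τ ∧ ∀ a, a + p < l → T (j + a) = T (j + a + p)

/-- The length-`τ` fragment at `j` is not highly periodic, but dropping its first letter makes
it so. -/
def IsLeftBoundary {α : Type*} (T : ℕ → α) (τ j : ℕ) : Prop :=
  ¬ HasShortPeriod T τ j τ ∧ HasShortPeriod T τ (j + 1) (τ - 1)

/-- The length-`τ` fragment at `j` is not highly periodic, but dropping its last letter makes
it so. -/
def IsRightBoundary {α : Type*} (T : ℕ → α) (τ j : ℕ) : Prop :=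
  ¬ HasShortPeriod T τ j τ ∧ HasShortPeriod T τ j (τ - 1)

/-- The length-`τ` fragment at `j` is at the boundary of a highly periodic region. -/
def IsBoundary {α : Type*} (T : ℕ → α) (τ j : ℕ) : Prop :=
  IsLeftBoundary T τ j ∨ IsRightBoundary T τ j

section Periods

variable {α : Type*} {T : ℕ → α} {τ : ℕ}

lemma three_mul_perOf_le_iff {i l : ℕ} (hl : 1 ≤ l) (hτ : τ ≤ l) :
    3 * perOf T i l ≤ τ ↔ HasShortPeriod T τ i l := by
  constructor
  · intro h
    have hne : {p | IsPeriod T i l p}.Nonempty := ⟨l, hl, le_rfl, fun a ha => by omega⟩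
    obtain ⟨h1, -, h3⟩ := Nat.sInf_mem hne
    exact ⟨_, h1, h, h3⟩
  · rintro ⟨p, h1, h2, h3⟩
    have : perOf T i l ≤ p := Nat.sInf_le ⟨h1, by omega, h3⟩
    omega

lemma HasShortPeriod.mono {i j l m : ℕ} (h : HasShortPeriod T τ i l) (hij : i ≤ j)
    (hjm : j + m ≤ i + l) : HasShortPeriod T τ j m := by
  obtain ⟨p, h1, h2, h3⟩ := h
  refine ⟨p, h1, h2, fun a ha => ?_⟩
  have := h3 (j - i + a) (by omega)
  rwa [show i + (j - i + a) = j + a by omega] at this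

lemma HasShortPeriod.congr {i j l : ℕ} (h : ∀ d < l, T (i + d) = T (j + d))
    (hi : HasShortPeriod T τ i l) : HasShortPeriod T τ j l := by
  obtain ⟨p, h1, h2, h3⟩ := hi
  refine ⟨p, h1, h2, fun a ha => ?_⟩
  rw [← h a (by omega), h3 a ha, add_assoc, h (a + p) ha, add_assoc]

lemma hasShortPeriod_congr {i j l : ℕ} (h : ∀ d < l, T (i + d) = T (j + d)) :
    HasShortPeriod T τ i l ↔ HasShortPeriod T τ j l :=
  ⟨.congr h, .congr fun d hd => (h d hd).symm⟩

lemma isBoundary_congr {i j : ℕ} (h : ∀ d < τ, T (i + d) = T (j + d)) :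
    IsBoundary T τ i ↔ IsBoundary T τ j := by
  have hl : ∀ d < τ - 1, T (i + 1 + d) = T (j + 1 + d) := fun d hd => by
    have := h (1 + d) (by omega)
    rwa [← add_assoc, ← add_assoc] at this
  have hr : ∀ d < τ - 1, T (i + d) = T (j + d) := fun d hd => h d (by omega)
  simp only [IsBoundary, IsLeftBoundary, IsRightBoundary, hasShortPeriod_congr h,
    hasShortPeriod_congr hl, hasShortPeriod_congr hr]

/-- Overlapping highly periodic fragments of length `τ` merge. -/
lemma hasShortPeriod_of_forall {i k : ℕ}
    (h : ∀ d ≤ k, HasShortPeriod T τ (i + d) τ) : HasShortPeriod T τ i (τ + k) := by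
  obtain ⟨p, hp1, hp2, hp⟩ := h 0 (Nat.zero_le _)
  refine ⟨p, hp1, hp2, ?_⟩
  induction k with
  | zero => exact hp
  | succ k ih =>
    intro a ha
    have ih := ih fun d hd => h d (by omega)
    by_cases hlt : a + p < τ + k
    · exact ih a hlt
    obtain ⟨q, hq1, hq2, hq⟩ := h (k + 1) le_rfl
    have e1 := hq (τ - 1 - q) (by omega)
    have e2 := ih (a - q) (by omega)
    have e3 := hq (τ - 1 - p - q) (by omega)
    rw [show i + (k + 1) + (τ - 1 - q) + q = i + a + p by omega,
      show i + (k + 1) + (τ - 1 - q) = i + (a - q) + p by omega] at e1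
    rw [show i + (k + 1) + (τ - 1 - p - q) + q = i + a by omega,
      show i + (k + 1) + (τ - 1 - p - q) = i + (a - q) by omega] at e3
    rw [← e1, ← e2, e3]

lemma IsLeftBoundary.spaced {i j : ℕ} (hi : IsLeftBoundary T τ i) (hj : IsLeftBoundary T τ j)
    (hij : i < j) : 3 * i + τ ≤ 3 * j := by
  by_contra! hlt
  obtain ⟨-, p, hp1, hp2, hp⟩ := hi
  obtain ⟨hj, q, hq1, hq2, hq⟩ := hj
  refine hj ⟨q, hq1, hq2, fun a ha => ?_⟩
  obtain _ | a := a
  · have e1 := hp (j - i - 1) (by omega)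
    have e2 := hq (p - 1) (by omega)
    have e3 := hp (j - i - 1 + q) (by omega)
    rw [show i + 1 + (j - i - 1) + p = j + p by omega,
      show i + 1 + (j - i - 1) = j by omega] at e1
    rw [show j + 1 + (p - 1) + q = j + p + q by omega,
      show j + 1 + (p - 1) = j + p by omega] at e2
    rw [show i + 1 + (j - i - 1 + q) + p = j + p + q by omega,
      show i + 1 + (j - i - 1 + q) = j + q by omega] at e3
    rw [add_zero, e1, e2, e3]
  · have := hq a (by omega)
    rwa [show j + 1 + a = j + (a + 1) by omega] at this

lemma IsRightBoundary.spaced {i j : ℕ} (hi : IsRightBoundary T τ i)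
    (hj : IsRightBoundary T τ j) (hij : i < j) : 3 * i + τ ≤ 3 * j := by
  by_contra! hlt
  obtain ⟨hi, p, hp1, hp2, hp⟩ := hi
  obtain ⟨-, q, hq1, hq2, hq⟩ := hj
  refine hi ⟨p, hp1, hp2, fun a ha => ?_⟩
  by_cases hlast : a + p < τ - 1
  · exact hp a hlast
  have e1 := hq (i + a + p - q - j) (by omega)
  have e2 := hp (a - q) (by omega)
  have e3 := hq (i + a - q - j) (by omega)
  rw [show j + (i + a + p - q - j) + q = i + a + p by omega,
    show j + (i + a + p - q - j) = i + (a - q) + p by omega] at e1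
  rw [show j + (i + a - q - j) + q = i + a by omega,
    show j + (i + a - q - j) = i + (a - q) by omega] at e3
  rw [← e1, ← e2, e3]

/-- Away from boundaries, all fragments of an interval are highly periodic or none is. -/
lemma hasShortPeriod_iff_of_not_isBoundary {i k : ℕ} (h : ∀ d ≤ k, ¬ IsBoundary T τ (i + d)) :
    ∀ d ≤ k, HasShortPeriod T τ (i + d) τ ↔ HasShortPeriod T τ i τ := by
  intro d
  induction d with
  | zero => simp
  | succ d ih =>
    intro hd
    rw [← ih (by omega)]
    constructor
    · intro h1
      by_contra h0
      exact h d (by omega) (.inl ⟨h0, h1.mono le_rfl (by omega)⟩)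
    · intro h0
      by_contra h1
      have : 1 ≤ τ := by
        obtain ⟨p, hp1, hp2, -⟩ := h0
        omega
      exact h (d + 1) hd (.inr ⟨h1, h0.mono (by omega) (by omega)⟩)

lemma hasShortPeriod_of_repeat {j k : ℕ} (hjk : j < k) (hk : 3 * k ≤ 3 * j + τ)
    (h : ∀ a < τ, T (j + a) = T (k + a)) : HasShortPeriod T τ j τ := by
  refine ⟨k - j, by omega, by omega, fun a ha => ?_⟩
  rw [h a (by omega)]
  congr 1
  omega

end Periods

lemma mul_card_le_of_spaced {n τ : ℕ} {s : Finset ℕ} (hτ : 1 ≤ τ) (hs : ∀ i ∈ s, i < n)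
    (h : ∀ i ∈ s, ∀ j ∈ s, i < j → 3 * i + τ ≤ 3 * j) : τ * s.card ≤ 3 * n + τ := by
  have hinj : Set.InjOn (fun i => 3 * i / τ) s := by
    have key : ∀ i ∈ s, ∀ j ∈ s, i < j → 3 * i / τ < 3 * j / τ := fun i hi j hj hij => by
      have := Nat.div_le_div_right (c := τ) (h i hi j hj hij)
      rw [Nat.add_div_right _ hτ] at this
      omega
    intro i hi j hj (hij : 3 * i / τ = 3 * j / τ)
    rcases lt_trichotomy i j with hlt | heq | hlt
    · exact absurd hij (key i hi j hj hlt).ne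
    · exact heq
    · exact absurd hij (key j hj i hi hlt).ne'
  have hcard : s.card ≤ (Finset.range (3 * n / τ + 1)).card := by
    refine Finset.card_le_card_of_injOn _ (fun i hi => ?_) hinj
    have : 3 * i / τ ≤ 3 * n / τ := Nat.div_le_div_right (by have := hs i hi; omega)
    simp only [Finset.coe_range, Set.mem_Iio]
    omega
  rw [Finset.card_range] at hcard
  calc τ * s.card ≤ τ * (3 * n / τ + 1) := Nat.mul_le_mul_left _ hcard
    _ = τ * (3 * n / τ) + τ := by ring
    _ ≤ 3 * n + τ := by have := Nat.mul_div_le (3 * n) τ; omega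

/-- A given element of `S` is first in `S` for at most a fraction `1 / |S|` of all orderings. -/
lemma card_mul_card_perm_min_le {m : ℕ} (S : Finset (Fin m)) {s : Fin m} (hs : s ∈ S) :
    S.card * (Finset.univ.filter fun σ : Equiv.Perm (Fin m) => ∀ t ∈ S, σ s ≤ σ t).card
      ≤ Fintype.card (Equiv.Perm (Fin m)) := by
  classical
  set F : Fin m → Finset (Equiv.Perm (Fin m)) :=
    fun u => Finset.univ.filter fun σ => ∀ t ∈ S, σ u ≤ σ t with hF
  have hle : ∀ u ∈ S, (F s).card ≤ (F u).card := by
    intro u hu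
    refine Finset.card_le_card_of_injOn (fun σ => σ * Equiv.swap s u) ?_
      (mul_left_injective _).injOn
    intro σ hσ
    have hσ' : ∀ t ∈ S, σ s ≤ σ t := by simpa [hF] using hσ
    simp only [hF, Finset.coe_filter, Finset.mem_univ, true_and, Set.mem_ofPred_eq,
      Equiv.Perm.mul_apply, Equiv.swap_apply_right]
    intro t ht
    refine hσ' _ ?_
    rcases eq_or_ne t s with rfl | h1
    · rwa [Equiv.swap_apply_left]
    rcases eq_or_ne t u with rfl | h2
    · rwa [Equiv.swap_apply_right]
    · rwa [Equiv.swap_apply_of_ne_of_ne h1 h2]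
  have hdisj : (S : Set (Fin m)).PairwiseDisjoint F := by
    intro u hu v hv huv
    refine Finset.disjoint_left.mpr fun σ h1 h2 => huv (σ.injective ?_)
    simp only [hF, Finset.mem_filter, Finset.mem_univ, true_and] at h1 h2
    exact le_antisymm (h1 v hv) (h2 u hu)
  calc S.card * (F s).card = ∑ _u ∈ S, (F s).card := by rw [Finset.sum_const, smul_eq_mul]
    _ ≤ ∑ u ∈ S, (F u).card := Finset.sum_le_sum hle
    _ = (S.biUnion F).card := (Finset.card_biUnion hdisj).symm
    _ ≤ _ := Finset.card_le_univ _

/-- Fragments of length `τ` starting in `[0..n]` can be labelled by elements of `Fin (n + 1)`. -/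
lemma exists_fragment_labelling {α : Type*} (n τ : ℕ) (T : ℕ → α) : ∃ r : ℕ → Fin (n + 1),
    (∀ i j, (∀ a < τ, T (i + a) = T (j + a)) → r i = r j) ∧
    ∀ i ≤ n, ∀ j ≤ n, r i = r j → ∀ a < τ, T (i + a) = T (j + a) := by
  set f : ℕ → ℕ := fun j => sInf {k | ∀ a < τ, T (k + a) = T (j + a)} with hf
  have hle : ∀ j, f j ≤ j := fun j => Nat.sInf_le fun a _ => rfl
  have hmem : ∀ j, ∀ a < τ, T (f j + a) = T (j + a) := fun j =>
    Nat.sInf_mem (s := {k | ∀ a < τ, T (k + a) = T (j + a)}) ⟨j, fun a _ => rfl⟩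
  refine ⟨fun j => ⟨min (f j) n, by omega⟩, fun i j h => ?_, fun i hi j hj h a ha => ?_⟩
  · have : f i = f j := by
      simp only [hf]
      congr 1
      ext k
      exact forall₂_congr fun a ha => by rw [h a ha]
    simp [this]
  · have h' : f i = f j := by
      have := congrArg Fin.val h
      simp only at this
      have := hle i
      have := hle j
      omega
    rw [← hmem i a ha, h', hmem j a ha]

/-- Among the starts in `[i..i+τ]` of fragments that are not highly periodic, `m` has the
least key. -/
def IsKeyMin {α : Type*} (T : ℕ → α) (τ : ℕ) (key : ℕ → ℕ) (i m : ℕ) : Prop :=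
  ¬ HasShortPeriod T τ m τ ∧
    ∀ d ≤ τ, ¬ HasShortPeriod T τ (i + d) τ → key m ≤ key (i + d)

open Classical in
/-- The synchronizing set determined by a key of the fragments of length `τ`. -/
noncomputable def keySyncSet {α : Type*} (n τ : ℕ) (T : ℕ → α) (key : ℕ → ℕ) : Finset ℕ :=
  (Finset.range n).filter fun i =>
    i + 2 * τ ≤ n ∧ (IsKeyMin T τ key i i ∨ IsKeyMin T τ key i (i + τ))

section KeySyncSet

variable {α : Type*} {T : ℕ → α} {n τ : ℕ} {key : ℕ → ℕ}

lemma mem_keySyncSet (hτ : 1 ≤ τ) {i : ℕ} : i ∈ keySyncSet n τ T key ↔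
    i + 2 * τ ≤ n ∧ (IsKeyMin T τ key i i ∨ IsKeyMin T τ key i (i + τ)) := by
  simp only [keySyncSet, Finset.mem_filter, Finset.mem_range, and_iff_right_iff_imp]
  omega

lemma isKeyMin_congr (hkey : ∀ i j, (∀ a < τ, T (i + a) = T (j + a)) → key i = key j)
    {i j e : ℕ} (he : e ≤ τ) (h : ∀ d < 2 * τ, T (i + d) = T (j + d)) :
    IsKeyMin T τ key i (i + e) ↔ IsKeyMin T τ key j (j + e) := by
  have hwin : ∀ d ≤ τ, ∀ a < τ, T (i + d + a) = T (j + d + a) := fun d hd a ha => by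
    have := h (d + a) (by omega)
    rwa [← add_assoc, ← add_assoc] at this
  unfold IsKeyMin
  rw [hasShortPeriod_congr (hwin e he), hkey _ _ (hwin e he)]
  refine and_congr_right fun _ => forall₂_congr fun d hd => ?_
  rw [hasShortPeriod_congr (hwin d hd), hkey _ _ (hwin d hd)]

lemma isSyncSet_keySyncSet (hτ : 1 ≤ τ)
    (hkey : ∀ i j, (∀ a < τ, T (i + a) = T (j + a)) → key i = key j) :
    IsSyncSet n τ T (keySyncSet n τ T key) := by
  classical
  refine ⟨fun a ha => ((mem_keySyncSet hτ).1 ha).1, fun i j hi hj h => ?_, fun i hi => ?_⟩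
  · rw [mem_keySyncSet hτ, mem_keySyncSet hτ]
    have h0 := isKeyMin_congr hkey (Nat.zero_le τ) h
    rw [add_zero, add_zero] at h0
    rw [h0, isKeyMin_congr hkey le_rfl h]
    simp only [hi, hj]
  rw [three_mul_perOf_le_iff (by omega) (by omega)]
  constructor
  · intro h
    rw [show 3 * τ - 1 = τ + (2 * τ - 1) by omega]
    apply hasShortPeriod_of_forall
    by_contra! hex
    obtain ⟨d₀, hd₀, hq₀⟩ := hex
    obtain ⟨d, hd, hmin⟩ := ((Finset.range (2 * τ)).filter
      fun d => ¬ HasShortPeriod T τ (i + d) τ).exists_min_image (fun d => key (i + d))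
      ⟨d₀, by simp only [Finset.mem_filter, Finset.mem_range]; exact ⟨by omega, hq₀⟩⟩
    simp only [Finset.mem_filter, Finset.mem_range] at hd hmin
    by_cases hlt : d < τ
    · refine h d hlt ((mem_keySyncSet hτ).2 ⟨by omega, .inl ⟨hd.2, fun e he hq => ?_⟩⟩)
      rw [add_assoc] at hq ⊢
      exact hmin (d + e) ⟨by omega, hq⟩
    · refine h (d - τ) (by omega) ((mem_keySyncSet hτ).2 ⟨by omega, .inr ?_⟩)
      rw [show i + (d - τ) + τ = i + d by omega]
      refine ⟨hd.2, fun e he hq => ?_⟩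
      rw [add_assoc] at hq ⊢
      exact hmin (d - τ + e) ⟨by omega, hq⟩
  · intro h d hd hmem
    rcases ((mem_keySyncSet hτ).1 hmem).2 with hm | hm
    · exact hm.1 (h.mono (by omega) (by omega))
    · exact hm.1 (h.mono (by omega) (by omega))

end KeySyncSet

open Classical in
/-- The key of a position under an ordering `σ` of the labels, boundary fragments first. -/
noncomputable def boundaryFirstKey {α : Type*} {n : ℕ} (τ : ℕ) (T : ℕ → α)
    (r : ℕ → Fin (n + 1)) (σ : Equiv.Perm (Fin (n + 1))) (j : ℕ) : ℕ :=
  if IsBoundary T τ j then (σ (r j) : ℕ) else n + 1 + σ (r j)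

open Classical in
/-- Positions of the synchronizing set whose window contains no boundary fragment. -/
noncomputable def boundaryFreePart {α : Type*} {n : ℕ} (τ : ℕ) (T : ℕ → α)
    (r : ℕ → Fin (n + 1)) (σ : Equiv.Perm (Fin (n + 1))) : Finset ℕ :=
  (keySyncSet n τ T (boundaryFirstKey τ T r σ)).filter
    fun i => ∀ d ≤ τ, ¬ IsBoundary T τ (i + d)

section Counting

variable {α : Type*} {T : ℕ → α} {n τ : ℕ} {r : ℕ → Fin (n + 1)}

open Classical in
lemma mul_card_boundary_le (hτ : 1 ≤ τ) :
    τ * ((Finset.range n).filter (IsBoundary T τ)).card ≤ 6 * n + 2 * τ := by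
  have hl := mul_card_le_of_spaced (n := n) (s := (Finset.range n).filter (IsLeftBoundary T τ)) hτ
    (fun i hi => Finset.mem_range.1 (Finset.mem_filter.1 hi).1)
    (by simp only [Finset.mem_filter]; exact fun i hi j hj => hi.2.spaced hj.2)
  have hr := mul_card_le_of_spaced (n := n) (s := (Finset.range n).filter (IsRightBoundary T τ)) hτ
    (fun i hi => Finset.mem_range.1 (Finset.mem_filter.1 hi).1)
    (by simp only [Finset.mem_filter]; exact fun i hi j hj => hi.2.spaced hj.2)
  have hunion : (Finset.range n).filter (IsBoundary T τ) =
      (Finset.range n).filter (IsLeftBoundary T τ) ∪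
        (Finset.range n).filter (IsRightBoundary T τ) := by
    rw [← Finset.filter_or]
    exact Finset.filter_congr fun i _ => Iff.rfl
  have := Nat.mul_le_mul_left τ (Finset.card_union_le
    ((Finset.range n).filter (IsLeftBoundary T τ)) ((Finset.range n).filter (IsRightBoundary T τ)))
  rw [hunion]
  linarith

open Classical in
lemma card_keySyncSet_le (hτ : 1 ≤ τ) (σ : Equiv.Perm (Fin (n + 1))) :
    (keySyncSet n τ T (boundaryFirstKey τ T r σ)).card ≤
      2 * ((Finset.range n).filter (IsBoundary T τ)).card + (boundaryFreePart τ T r σ).card := by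
  set B := (Finset.range n).filter (IsBoundary T τ)
  have hsub : keySyncSet n τ T (boundaryFirstKey τ T r σ) ⊆
      (B ∪ B.image (· - τ)) ∪ boundaryFreePart τ T r σ := by
    intro i hi
    have hi' := (mem_keySyncSet hτ).1 hi
    by_cases hfree : ∀ d ≤ τ, ¬ IsBoundary T τ (i + d)
    · exact Finset.mem_union_right _ (Finset.mem_filter.2 ⟨hi, hfree⟩)
    push Not at hfree
    obtain ⟨d, hd, hb⟩ := hfree
    have hbound : ∀ m, IsKeyMin T τ (boundaryFirstKey τ T r σ) i m → IsBoundary T τ m := by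
      intro m hm
      have hq : ¬ HasShortPeriod T τ (i + d) τ := hb.elim And.left And.left
      have hle := hm.2 d hd hq
      by_contra hnb
      have := (σ (r (i + d))).isLt
      simp only [boundaryFirstKey, if_pos hb, if_neg hnb] at hle
      omega
    refine Finset.mem_union_left _ ?_
    rcases hi'.2 with h | h
    · exact Finset.mem_union_left _
        (Finset.mem_filter.2 ⟨Finset.mem_range.2 (by omega), hbound _ h⟩)
    · exact Finset.mem_union_right _ (Finset.mem_image.2
        ⟨i + τ, Finset.mem_filter.2 ⟨Finset.mem_range.2 (by omega), hbound _ h⟩, by simp⟩)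
  have h1 := Finset.card_le_card hsub
  have h2 := Finset.card_union_le (B ∪ B.image (· - τ)) (boundaryFreePart τ T r σ)
  have h3 := Finset.card_union_le B (B.image (· - τ))
  have h4 : (B.image (· - τ)).card ≤ B.card := Finset.card_image_le
  omega

/-- Few orderings give a label at `m` the first place among `⌊τ / 3⌋ + 1` consecutive fragments
that are not highly periodic. -/
lemma mul_card_perm_first_le
    (hr : ∀ i ≤ n, ∀ j ≤ n, r i = r j → ∀ a < τ, T (i + a) = T (j + a)) {i m : ℕ}
    (hi : i + τ / 3 ≤ n) (hq : ∀ d ≤ τ / 3, ¬ HasShortPeriod T τ (i + d) τ) (him : i ≤ m)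
    (hm : m ≤ i + τ / 3) :
    τ * (Finset.univ.filter fun σ : Equiv.Perm (Fin (n + 1)) =>
        ∀ d ≤ τ / 3, σ (r m) ≤ σ (r (i + d))).card
      ≤ 3 * Fintype.card (Equiv.Perm (Fin (n + 1))) := by
  classical
  set S : Finset (Fin (n + 1)) := (Finset.range (τ / 3 + 1)).image fun d => r (i + d) with hS
  have hne : ∀ d ≤ τ / 3, ∀ e ≤ τ / 3, d < e → r (i + d) ≠ r (i + e) := fun d hd e he hde h =>
    hq d hd (hasShortPeriod_of_repeat (k := i + e) (by omega) (by omega)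
      (hr _ (by omega) _ (by omega) h))
  have hcard : S.card = τ / 3 + 1 := by
    rw [hS, Finset.card_image_of_injOn, Finset.card_range]
    intro d hd e he h
    simp only [Finset.coe_range, Set.mem_Iio] at hd he
    rcases lt_trichotomy d e with hlt | heq | hlt
    · exact absurd h (hne d (by omega) e (by omega) hlt)
    · exact heq
    · exact absurd h.symm (hne e (by omega) d (by omega) hlt)
  have hmS : r m ∈ S := Finset.mem_image.2
    ⟨m - i, Finset.mem_range.2 (by omega), by rw [Nat.add_sub_cancel' him]⟩
  have hmain := card_mul_card_perm_min_le S hmS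
  have hfilter : (Finset.univ.filter fun σ : Equiv.Perm (Fin (n + 1)) =>
      ∀ t ∈ S, σ (r m) ≤ σ t) = Finset.univ.filter fun σ : Equiv.Perm (Fin (n + 1)) =>
      ∀ d ≤ τ / 3, σ (r m) ≤ σ (r (i + d)) := by
    ext σ
    simp [hS]
  rw [hcard, hfilter] at hmain
  calc _ ≤ 3 * (τ / 3 + 1) * _ := Nat.mul_le_mul_right _ (by omega)
    _ ≤ _ := by rw [mul_assoc]; exact Nat.mul_le_mul_left 3 hmain

open Classical in
lemma mul_card_perm_mem_boundaryFreePart_le (hτ : 1 ≤ τ)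
    (hr : ∀ i ≤ n, ∀ j ≤ n, r i = r j → ∀ a < τ, T (i + a) = T (j + a)) (i : ℕ) :
    τ * (Finset.univ.filter fun σ : Equiv.Perm (Fin (n + 1)) =>
        i ∈ boundaryFreePart τ T r σ).card
      ≤ 6 * Fintype.card (Equiv.Perm (Fin (n + 1))) := by
  by_cases hin : i + 2 * τ ≤ n
  swap
  · rw [Finset.filter_false_of_mem]
    · simp
    · exact fun σ _ h => hin ((mem_keySyncSet hτ).1 (Finset.mem_filter.1 h).1).1
  by_cases hgood : ∀ d ≤ τ, ¬ IsBoundary T τ (i + d) ∧ ¬ HasShortPeriod T τ (i + d) τ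
  swap
  · rw [Finset.filter_false_of_mem]
    · simp
    intro σ _ h
    obtain ⟨h1, hfree⟩ := Finset.mem_filter.1 h
    have hiff := hasShortPeriod_iff_of_not_isBoundary hfree
    refine hgood fun d hd => ⟨hfree d hd, ?_⟩
    rw [hiff d hd]
    rcases ((mem_keySyncSet hτ).1 h1).2 with h2 | h2
    · exact h2.1
    · rw [← hiff τ le_rfl]
      exact h2.1
  have hfirst : ∀ σ, ∀ e ≤ τ, IsKeyMin T τ (boundaryFirstKey τ T r σ) i (i + e) →
      ∀ d ≤ τ, σ (r (i + e)) ≤ σ (r (i + d)) := by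
    intro σ e he h d hd
    have := h.2 d hd (hgood d hd).2
    simp only [boundaryFirstKey, if_neg (hgood d hd).1, if_neg (hgood e he).1] at this
    rw [Fin.le_def]
    omega
  have hl := mul_card_perm_first_le hr (i := i) (m := i) (by omega)
    (fun d hd => (hgood d (by omega)).2) le_rfl (by omega)
  have hr' := mul_card_perm_first_le hr (i := i + (τ - τ / 3)) (m := i + τ) (by omega)
    (fun d hd => by rw [add_assoc]; exact (hgood _ (by omega)).2) (by omega) (by omega)
  have hsub : (Finset.univ.filter fun σ : Equiv.Perm (Fin (n + 1)) =>
        i ∈ boundaryFreePart τ T r σ) ⊆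
      (Finset.univ.filter fun σ : Equiv.Perm (Fin (n + 1)) =>
        ∀ d ≤ τ / 3, σ (r i) ≤ σ (r (i + d))) ∪
      (Finset.univ.filter fun σ : Equiv.Perm (Fin (n + 1)) =>
        ∀ d ≤ τ / 3, σ (r (i + τ)) ≤ σ (r (i + (τ - τ / 3) + d))) := by
    intro σ hσ
    have h1 := (Finset.mem_filter.1 (Finset.mem_filter.1 hσ).2).1
    rcases ((mem_keySyncSet hτ).1 h1).2 with h2 | h2
    · refine Finset.mem_union_left _ (Finset.mem_filter.2 ⟨Finset.mem_univ _, fun d hd => ?_⟩)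
      exact hfirst σ 0 (Nat.zero_le _) h2 d (by omega)
    · refine Finset.mem_union_right _ (Finset.mem_filter.2 ⟨Finset.mem_univ _, fun d hd => ?_⟩)
      rw [add_assoc]
      exact hfirst σ τ le_rfl h2 _ (by omega)
  have := Nat.mul_le_mul_left τ ((Finset.card_le_card hsub).trans (Finset.card_union_le _ _))
  linarith

lemma exists_perm_mul_card_boundaryFreePart_le (hτ : 1 ≤ τ)
    (hr : ∀ i ≤ n, ∀ j ≤ n, r i = r j → ∀ a < τ, T (i + a) = T (j + a)) :
    ∃ σ, τ * (boundaryFreePart τ T r σ).card ≤ 6 * n := by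
  classical
  have hcount : ∑ σ : Equiv.Perm (Fin (n + 1)), (boundaryFreePart τ T r σ).card =
      ∑ i ∈ Finset.range n, (Finset.univ.filter fun σ : Equiv.Perm (Fin (n + 1)) =>
        i ∈ boundaryFreePart τ T r σ).card := by
    refine Eq.trans ?_ (Finset.sum_card_bipartiteAbove_eq_sum_card_bipartiteBelow
      (fun σ i => i ∈ boundaryFreePart τ T r σ))
    refine Finset.sum_congr rfl fun σ _ => congrArg Finset.card ?_
    ext i
    simp only [Finset.bipartiteAbove, Finset.mem_filter, Finset.mem_range,
      iff_and_self]
    exact fun h => Finset.mem_range.1 (Finset.mem_filter.1 (Finset.mem_filter.1 h).1).1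
  obtain ⟨σ, -, hσ⟩ := Finset.exists_le_of_sum_le
    (f := fun σ : Equiv.Perm (Fin (n + 1)) => τ * (boundaryFreePart τ T r σ).card)
    (g := fun _ => 6 * n) Finset.univ_nonempty (by
      rw [← Finset.mul_sum, hcount, Finset.mul_sum, Finset.sum_const, smul_eq_mul,
        Finset.card_univ]
      calc _ ≤ ∑ _i ∈ Finset.range n, 6 * Fintype.card (Equiv.Perm (Fin (n + 1))) :=
            Finset.sum_le_sum fun i _ => mul_card_perm_mem_boundaryFreePart_le hτ hr i
        _ = _ := by rw [Finset.sum_const, Finset.card_range, smul_eq_mul]; ring)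
  exact ⟨σ, hσ⟩

end Counting

/-- there is a constant `C > 0` such that every length-`n` string over any
alphabet has, for every `1 ≤ τ ≤ n/2`, a `τ`-synchronizing set of size at most `C·n/τ`. -/
theorem stmt4 : ∃ C : ℝ, 0 < C ∧
    ∀ (α : Type) (n τ : ℕ) (T : ℕ → α), 1 ≤ τ → 2 * τ ≤ n →
      ∃ A : Finset ℕ, IsSyncSet n τ T A ∧ (A.card : ℝ) ≤ C * n / τ := by
  classical
  refine ⟨22, by norm_num, fun α n τ T hτ hn => ?_⟩
  obtain ⟨r, hr₁, hr₂⟩ := exists_fragment_labelling n τ T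
  obtain ⟨σ, hσ⟩ := exists_perm_mul_card_boundaryFreePart_le hτ hr₂
  refine ⟨keySyncSet n τ T (boundaryFirstKey τ T r σ),
    isSyncSet_keySyncSet hτ fun i j h => ?_, ?_⟩
  · simp only [boundaryFirstKey, isBoundary_congr h, hr₁ i j h]
  · have h1 := Nat.mul_le_mul_left τ (card_keySyncSet_le (T := T) (r := r) hτ σ)
    have h2 := mul_card_boundary_le (T := T) (n := n) hτ
    rw [le_div_iff₀ (by exact_mod_cast hτ)]
    have h3 : (keySyncSet n τ T (boundaryFirstKey τ T r σ)).card * τ ≤ 22 * n := by linarith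
    exact_mod_cast h3
end

section
/- There exists a constant C > 0 such that every string of length n contains at most C·n/τ τ-runs, for every integer τ ∈ [1..n]. -/
theorem perOf_isPeriod {α : Type*} (S : ℕ → α) (x len : ℕ) (h : 1 ≤ len) :
    IsPeriod S x len (perOf S x len) :=
  Nat.sInf_mem (s := {p | IsPeriod S x len p}) ⟨len, h, le_rfl, fun a ha => by omega⟩

theorem perOf_le {α : Type*} {S : ℕ → α} {x len p : ℕ} (h : IsPeriod S x len p) :
    perOf S x len ≤ p :=
  Nat.sInf_le h

theorem IsPeriod.apply_eq {α : Type*} {T : ℕ → α} {x y p : ℕ}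
    (h : IsPeriod T x (y - x + 1) p) {a : ℕ} (hx : x ≤ a) (hy : a + p ≤ y) :
    T a = T (a + p) := by
  have := h.2.2 (a - x) (by omega)
  rwa [Nat.add_sub_cancel' hx] at this

theorem IsPeriod.apply_eq_of_modEq {α : Type*} {T : ℕ → α} {x y p : ℕ}
    (h : IsPeriod T x (y - x + 1) p) {a b : ℕ} (hxa : x ≤ a) (hay : a ≤ y)
    (hxb : x ≤ b) (hby : b ≤ y) (hab : a ≡ b [MOD p]) : T a = T b := by
  have key : ∀ k c : ℕ, x ≤ c → c + p * k ≤ y → T c = T (c + p * k) := by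
    intro k
    induction k with
    | zero => intro c _ _; simp
    | succ k ih =>
      intro c hc hy
      rw [Nat.mul_succ] at hy ⊢
      rw [ih c hc (by omega), h.apply_eq (by omega) (by omega), add_assoc]
  rcases le_total a b with hle | hle
  · obtain ⟨k, hk⟩ := (Nat.modEq_iff_dvd' hle).1 hab
    have hb : b = a + p * k := by omega
    subst hb
    exact key k a hxa hby
  · obtain ⟨k, hk⟩ := (Nat.modEq_iff_dvd' hle).1 hab.symm
    have ha : a = b + p * k := by omega
    subst ha
    exact (key k b hxb hay).symm

/-- A period `p` of one fragment is a period of any `q`-periodic fragment that overlaps it in at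
least `p + q` positions. -/
theorem IsPeriod.of_overlap {α : Type*} {T : ℕ → α} {x y x' y' p q : ℕ}
    (hp : IsPeriod T x (y - x + 1) p) (hq : IsPeriod T x' (y' - x' + 1) q)
    (hov : max x x' + p + q ≤ min y y' + 1) :
    IsPeriod T x' (y' - x' + 1) p := by
  have hp1 := hp.1
  have hq1 := hq.1
  refine ⟨hp1, by omega, fun d hd => ?_⟩
  obtain ⟨b, hb1, hb2, hb3⟩ :
      ∃ b, max x x' ≤ b ∧ b < max x x' + q ∧ b ≡ x' + d [MOD q] := by
    generalize max x x' = L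
    have hL : L ≤ q * L := Nat.le_mul_of_pos_left L hq1
    refine ⟨L + (x' + d + q * L - L) % q, by omega,
      by have := Nat.mod_lt (x' + d + q * L - L) hq1; omega, ?_⟩
    have h1 : L + (x' + d + q * L - L) % q ≡ L + (x' + d + q * L - L) [MOD q] :=
      (Nat.mod_modEq _ _).add_left L
    rw [show L + (x' + d + q * L - L) = x' + d + q * L by omega] at h1
    exact h1.trans (by simp [Nat.ModEq])
  calc T (x' + d) = T b :=
        hq.apply_eq_of_modEq (by omega) (by omega) (by omega) (by omega) hb3.symm
    _ = T (b + p) := hp.apply_eq (by omega) (by omega)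
    _ = T (x' + d + p) :=
        hq.apply_eq_of_modEq (by omega) (by omega) (by omega) (by omega) (hb3.add_right p)

/-- Two runs whose overlap is at least the sum of their periods coincide. -/
theorem IsRun.eq_of_overlap {α : Type*} {n : ℕ} {T : ℕ → α} {x y x' y' : ℕ}
    (h : IsRun n T x y) (h' : IsRun n T x' y')
    (hov : max x x' + perOf T x (y - x + 1) + perOf T x' (y' - x' + 1) ≤ min y y' + 1) :
    x = x' ∧ y = y' := by
  obtain ⟨hxy, hyn, -, hl, hr⟩ := h
  obtain ⟨hxy', hyn', -, hl', hr'⟩ := h'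
  have hp := perOf_isPeriod T x (y - x + 1) (by omega)
  have hq := perOf_isPeriod T x' (y' - x' + 1) (by omega)
  have hqp := perOf_le (hp.of_overlap hq hov)
  have hpq := perOf_le (hq.of_overlap hp (by omega))
  have heq := le_antisymm hpq hqp
  rw [← heq] at hq hov hl' hr'
  generalize perOf T x (y - x + 1) = p at *
  have hp1 := hp.1
  refine ⟨?_, ?_⟩
  · rcases lt_trichotomy x x' with hlt | rfl | hlt
    · rcases hl' with h0 | hne
      · omega
      · exact absurd (hp.apply_eq (by omega) (by omega)) hne
    · rfl
    · rcases hl with h0 | hne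
      · omega
      · exact absurd (hq.apply_eq (by omega) (by omega)) hne
  · rcases lt_trichotomy y y' with hlt | rfl | hlt
    · rcases hr with h0 | hne
      · omega
      · have := hq.apply_eq (a := y + 1 - p) (by omega) (by omega)
        rw [Nat.sub_add_cancel (by omega)] at this
        exact absurd this.symm hne
    · rfl
    · rcases hr' with h0 | hne
      · omega
      · have := hp.apply_eq (a := y' + 1 - p) (by omega) (by omega)
        rw [Nat.sub_add_cancel (by omega)] at this
        exact absurd this.symm hne

/-- Distinct `τ`-runs start in distinct blocks of length `τ`. -/
theorem injOn_isTauRun {α : Type*} {n τ : ℕ} {T : ℕ → α} (hτ : 1 ≤ τ) :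
    Set.InjOn (fun p : ℕ × ℕ => p.1 / τ) {p : ℕ × ℕ | IsTauRun n T τ p.1 p.2} := by
  rintro ⟨x, y⟩ ⟨h, hlen, hper⟩ ⟨x', y'⟩ ⟨h', hlen', hper'⟩ hxx
  simp only at h hlen hper h' hlen' hper' hxx
  have h1 := Nat.div_add_mod x τ
  have h2 := Nat.div_add_mod x' τ
  have h3 := Nat.mod_lt x hτ
  have h4 := Nat.mod_lt x' hτ
  rw [hxx] at h1
  have hxy := h.1
  have hxy' := h'.1
  obtain ⟨rfl, rfl⟩ := h.eq_of_overlap h' (by omega)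
  rfl

/-- there is a constant `C > 0` such that every length-`n` string contains
at most `C·n/τ` `τ`-runs, for every `τ ∈ [1..n]`. -/
theorem stmt5 : ∃ C : ℝ, 0 < C ∧
    ∀ (α : Type) (n τ : ℕ) (T : ℕ → α), 1 ≤ τ → τ ≤ n →
      {p : ℕ × ℕ | IsTauRun n T τ p.1 p.2}.Finite ∧
      ({p : ℕ × ℕ | IsTauRun n T τ p.1 p.2}.ncard : ℝ) ≤ C * n / τ := by
  refine ⟨2, by norm_num, fun α n τ T hτ hn => ?_⟩
  have hmaps : Set.MapsTo (fun p : ℕ × ℕ => p.1 / τ) {p : ℕ × ℕ | IsTauRun n T τ p.1 p.2}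
      (Finset.range (n / τ + 1) : Set ℕ) := by
    rintro ⟨x, y⟩ ⟨⟨hxy, hyn, -⟩, -⟩
    have : x / τ ≤ n / τ := Nat.div_le_div_right (by omega)
    simpa using Nat.lt_succ_of_le this
  have hinj := injOn_isTauRun (n := n) (T := T) hτ
  refine ⟨Set.Finite.of_injOn hmaps hinj (Finset.finite_toSet _), ?_⟩
  have hcard := Set.ncard_le_ncard_of_injOn _ hmaps hinj (Finset.finite_toSet _)
  rw [Set.ncard_coe_finset, Finset.card_range] at hcard
  have hτ' : (0 : ℝ) < τ := by exact_mod_cast hτ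
  rw [le_div_iff₀ hτ']
  have h1 : (n / τ + 1) * τ ≤ 2 * n := by
    have := Nat.div_mul_le_self n τ
    rw [add_mul]
    omega
  exact_mod_cast (Nat.mul_le_mul_right τ hcard).trans h1
end

section
/- Let T be a string and let T[x1..y1] and T[x2..y2] be two distinct runs of T that have the same smallest period p. Then the two runs intersect in at most p−1 positions, i.e., |[x1..y1] ∩ [x2..y2]| ≤ p−1. -/
/-- The smallest period of a nonempty fragment is a period of it. -/
theorem isPeriod_perOf {α : Type*} (S : ℕ → α) (x : ℕ) {len : ℕ} (h : 1 ≤ len) :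
    IsPeriod S x len (perOf S x len) :=
  Nat.sInf_mem (s := {p | IsPeriod S x len p}) ⟨len, h, le_rfl, fun a ha => by omega⟩

/-- Letters of the fragment `T[x..y]` at distance the smallest period agree. -/
theorem perOf_apply {α : Type*} (T : ℕ → α) {x y i : ℕ} (hx : x ≤ i)
    (hy : i + perOf T x (y - x + 1) ≤ y) : T i = T (i + perOf T x (y - x + 1)) := by
  have h := (isPeriod_perOf T x (Nat.le_add_left 1 (y - x))).2.2 (i - x) (by omega)
  rwa [Nat.add_sub_cancel' hx] at h

/-- A run that shares at least its smallest period many positions with another run of the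
same smallest period contains that run. -/
theorem IsRun.contains {α : Type*} {n : ℕ} {T : ℕ → α} {x1 y1 x2 y2 : ℕ}
    (h1 : IsRun n T x1 y1) (h2 : IsRun n T x2 y2)
    (hp : perOf T x1 (y1 - x1 + 1) = perOf T x2 (y2 - x2 + 1))
    (hov : max x1 x2 + perOf T x1 (y1 - x1 + 1) ≤ min y1 y2 + 1) :
    x1 ≤ x2 ∧ y2 ≤ y1 := by
  obtain ⟨-, -, -, hl, hr⟩ := h1
  obtain ⟨-, hn, -⟩ := h2
  rw [hp] at hl hr hov
  constructor
  · by_contra! hlt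
    exact hl.resolve_left (by omega) (perOf_apply T (by omega) (by omega))
  · by_contra! hlt
    have h := perOf_apply T (x := x2) (y := y2)
      (i := y1 + 1 - perOf T x2 (y2 - x2 + 1)) (by omega) (by omega)
    rw [Nat.sub_add_cancel (by omega)] at h
    exact hr.resolve_left (by omega) h.symm

/-- two distinct runs of `T` with the same smallest period `p`
intersect in at most `p - 1` positions. -/
theorem stmt6 {α : Type*} (n : ℕ) (T : ℕ → α) (x1 y1 x2 y2 : ℕ)
    (h1 : IsRun n T x1 y1) (h2 : IsRun n T x2 y2)
    (hne : (x1, y1) ≠ (x2, y2))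
    (hp : perOf T x1 (y1 - x1 + 1) = perOf T x2 (y2 - x2 + 1)) :
    (Finset.Icc x1 y1 ∩ Finset.Icc x2 y2).card ≤ perOf T x1 (y1 - x1 + 1) - 1 := by
  have hpos := (isPeriod_perOf T x1 (Nat.le_add_left 1 (y1 - x1))).1
  have hcap : Finset.Icc x1 y1 ∩ Finset.Icc x2 y2 = Finset.Icc (max x1 x2) (min y1 y2) := by
    ext i
    simp only [Finset.mem_inter, Finset.mem_Icc]
    omega
  rw [hcap, Nat.card_Icc]
  by_contra! hlt
  have hov : max x1 x2 + perOf T x1 (y1 - x1 + 1) ≤ min y1 y2 + 1 := by omega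
  have h12 := h1.contains h2 hp hov
  have h21 := h2.contains h1 hp.symm (by rwa [max_comm, min_comm, ← hp])
  exact hne (Prod.ext (le_antisymm h12.1 h21.1) (le_antisymm h21.2 h12.2))
end

section
/- For every positive integer μ and every integer x with 0 ≤ x < μ, the number of integers t ∈ [1..μ] such that t − f(t) ≤ x < t (i.e., such that x is covered by the base interval [t − f(t) .. t)) is at most ⌊log₂ μ⌋ + 1. -/
/-- `f(t)`: the largest power of two dividing `t`. -/
def fPow2 (t : ℕ) : ℕ := 2 ^ padicValNat 2 t

theorem fPow2_dvd (t : ℕ) : fPow2 t ∣ t := pow_padicValNat_dvd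

theorem fPow2_pos (t : ℕ) : 0 < fPow2 t := by
  unfold fPow2
  positivity

/-- The only multiple `t` of `d` with `t - d ≤ x < t` is `d * (x / d + 1)`. -/
theorem eq_mul_div_add_one_of_dvd {d t x : ℕ} (hd : 0 < d) (hdt : d ∣ t)
    (hle : t - d ≤ x) (hlt : x < t) : t = d * (x / d + 1) := by
  obtain ⟨a, rfl⟩ := hdt
  congr 1
  have hlow : x / d < a := (Nat.div_lt_iff_lt_mul hd).2 (by rwa [mul_comm])
  have hhigh : a - 1 ≤ x / d := by
    rw [Nat.le_div_iff_mul_le hd, Nat.sub_mul, one_mul, mul_comm]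
    exact hle
  omega

/-- for `0 ≤ x < μ`, the number of `t ∈ [1..μ]` whose base interval
`[t - f(t) .. t)` covers `x` is at most `⌊log₂ μ⌋ + 1`. -/
theorem stmt11 (μ : ℕ) (hμ : 0 < μ) (x : ℕ) (hx : x < μ) :
    ((Finset.Icc 1 μ).filter fun t => t - fPow2 t ≤ x ∧ x < t).card ≤
      Nat.log 2 μ + 1 := by
  rw [← Finset.card_range (Nat.log 2 μ + 1)]
  refine Finset.card_le_card_of_injOn (padicValNat 2) ?_ ?_
  · intro t ht
    simp only [Finset.coe_filter, Finset.mem_Icc, Set.mem_ofPred_eq] at ht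
    simp only [Finset.coe_range, Set.mem_Iio, Nat.lt_succ_iff]
    exact (padicValNat_le_nat_log t).trans (Nat.log_mono_right ht.1.2)
  · intro s hs t ht hst
    simp only [Finset.coe_filter, Set.mem_ofPred_eq] at hs ht
    have hf : fPow2 s = fPow2 t := congrArg (2 ^ ·) hst
    rw [eq_mul_div_add_one_of_dvd (fPow2_pos s) (fPow2_dvd s) hs.2.1 hs.2.2, hf]
    exact (eq_mul_div_add_one_of_dvd (fPow2_pos t) (fPow2_dvd t) ht.2.1 ht.2.2).symm
end
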